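/- arXiv:0706.4298 — 4 statements merged into one kernel-verified Lean document; each statement's English description precedes it below -/
import Mathlib

section
/- Let k ≥ max_{p∈V} ℓ_0 p and let (p,t) be an event with t ≥ t_{p,k}. Then: (a) for every q ∈ V with d(q,p) ≤ ℓ_t p − k, there exists an event (q,t') with t_{q,k} ≤ t' and an in-segment causal chain from (q,t') to (p,t) (so V(p, ℓ_t p − k) ⊆ Cover(p,t) within the segment [C_k, →[); and (b) every simple walk of length at most ℓ_t p − k ending at p belongs to WalkCover_k(p,t), i.e. Σ_p^{ℓ_t p − k} ⊆ WalkCover_k(p,t). -/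
/-- `(p,0)` is an event for every `p`, and `(p,t+1)` is an event iff `p ∈ A t`. -/
def IsEvent {V : Type*} (A : ℕ → Set V) (p : V) (t : ℕ) : Prop :=
  t = 0 ∨ ∃ t', t = t' + 1 ∧ p ∈ A t'

/-- The causal relation `⇝` on events. -/
def Leadsto {V : Type*} (G : SimpleGraph V) (A : ℕ → Set V) (e f : V × ℕ) : Prop :=
  (e.1 = f.1 ∨ G.Adj e.1 f.1) ∧ IsEvent A f.1 f.2 ∧ 0 < f.2 ∧
    IsEvent A e.1 e.2 ∧ e.2 < f.2 ∧ ∀ s, e.2 < s → s < f.2 → ¬ IsEvent A e.1 s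

/-- A walk in `G`. -/
def IsWalk {V : Type*} (G : SimpleGraph V) (m : List V) : Prop :=
  m ≠ [] ∧ m.Chain' (fun a b => a = b ∨ G.Adj a b)

/-- `WalkCover_k(p,t)`: walks associated to in-segment causal chains ending at
`(p,t)` (each event `(q,t')` of the chain satisfies `t' ≥ t_{q,k}`), together
with the length-0 walk `p`. -/
def WalkCoverSeg {V : Type*} (G : SimpleGraph V) (A : ℕ → Set V) (tk : V → ℕ)
    (p : V) (t : ℕ) : Set (List V) :=
  {m | m = [p] ∨ ∃ C : List (V × ℕ), C ≠ [] ∧ List.Chain' (Leadsto G A) C ∧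
    C.getLast? = some (p, t) ∧ (∀ e ∈ C, tk e.1 ≤ e.2) ∧ m = C.map Prod.fst}

theorem isEvent_succ_iff {V : Type*} (A : ℕ → Set V) (p : V) (t : ℕ) :
    IsEvent A p (t + 1) ↔ p ∈ A t := by
  simp [IsEvent]

/-- Every process has a last event up to time `s`, and keeps its level from then until `s`. -/
theorem exists_last_event {V : Type*} (ℓ : ℕ → V → ℤ) (A : ℕ → Set V)
    (hstay : ∀ t, ∀ p, p ∉ A t → ℓ (t + 1) p = ℓ t p) (q : V) (s : ℕ) :
    ∃ t', t' ≤ s ∧ IsEvent A q t' ∧ (∀ r, t' < r → r < s + 1 → ¬ IsEvent A q r) ∧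
      ℓ t' q = ℓ s q := by
  induction s with
  | zero => exact ⟨0, le_rfl, Or.inl rfl, fun r h1 h2 => by omega, rfl⟩
  | succ s ih =>
    by_cases h : q ∈ A s
    · exact ⟨s + 1, le_rfl, (isEvent_succ_iff A q s).2 h, fun r h1 h2 => by omega, rfl⟩
    · obtain ⟨t', h1, h2, h3, h4⟩ := ih
      refine ⟨t', by omega, h2, fun r hr1 hr2 => ?_, by rw [h4, hstay s q h]⟩
      rcases Nat.lt_or_ge r (s + 1) with hr | hr
      · exact h3 r hr1 hr
      · obtain rfl : r = s + 1 := by omega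
        rwa [isEvent_succ_iff]

theorem level_mono {V : Type*} (ℓ : ℕ → V → ℤ) (A : ℕ → Set V)
    (hfire : ∀ t, ∀ p ∈ A t, ℓ (t + 1) p = ℓ t p + 1)
    (hstay : ∀ t, ∀ p, p ∉ A t → ℓ (t + 1) p = ℓ t p) (p : V) :
    Monotone fun t => ℓ t p := by
  refine monotone_nat_of_le_succ fun t => ?_
  by_cases h : p ∈ A t
  · have := hfire t p h
    omega
  · exact (hstay t p h).ge

/-- Every walk, simple or not, whose length is at most the number of steps made by its endpoint
since level `k` is the trace of an in-segment causal chain. -/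
theorem exists_causal_chain_of_walk {V : Type*} (G : SimpleGraph V)
    (ℓ : ℕ → V → ℤ) (A : ℕ → Set V)
    (hguard : ∀ t, ∀ p ∈ A t, ∀ q, G.Adj p q → ℓ t q = ℓ t p ∨ ℓ t q = ℓ t p + 1)
    (hfire : ∀ t, ∀ p ∈ A t, ℓ (t + 1) p = ℓ t p + 1)
    (hstay : ∀ t, ∀ p, p ∉ A t → ℓ (t + 1) p = ℓ t p)
    (k : ℤ) (hk : ∀ p : V, ℓ 0 p ≤ k) (tk : V → ℕ)
    (htk : ∀ p : V, ℓ (tk p) p = k ∧ ∀ t, ℓ t p = k → tk p ≤ t)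
    (m : List V) (hm : m.IsChain (fun a b => a = b ∨ G.Adj a b)) :
    ∀ (p : V) (t : ℕ), IsEvent A p t → tk p ≤ t → m.getLast? = some p →
      (m.length : ℤ) - 1 ≤ ℓ t p - k →
      ∃ C : List (V × ℕ), C.IsChain (Leadsto G A) ∧ C.getLast? = some (p, t) ∧
        (∀ e ∈ C, tk e.1 ≤ e.2) ∧ m = C.map Prod.fst := by
  induction m using List.reverseRecOn with
  | nil => simp
  | append_singleton m x ih =>
    intro p t hev htp hlast hlen
    obtain rfl : x = p := by simpa using hlast
    rcases List.eq_nil_or_concat m with rfl | ⟨m', q, rfl⟩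
    · exact ⟨[(x, t)], by simp, by simp, by simpa using htp, by simp⟩
    · rw [List.concat_eq_append] at *
      rw [List.isChain_append] at hm
      obtain ⟨hm, -, hqx⟩ := hm
      have hqx : q = x ∨ G.Adj q x := by simpa using hqx
      have hlen' : (m'.length : ℤ) + 1 ≤ ℓ t x - k := by
        simp only [List.length_append, List.length_cons, List.length_nil] at hlen
        push_cast at hlen
        omega
      obtain _ | s := t
      · have := hk x
        omega
      · have hx : x ∈ A s := (isEvent_succ_iff A x s).1 hev
        have hxs := hfire s x hx
        have hq : ℓ s x ≤ ℓ s q := by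
          rcases hqx with rfl | h
          · exact le_rfl
          · have := hguard s x hx q h.symm
            omega
        obtain ⟨t', h1, h2, h3, h4⟩ := exists_last_event ℓ A hstay q s
        have htq : tk q ≤ t' := by
          by_contra! hlt
          have hle : ℓ t' q ≤ ℓ (tk q) q := level_mono ℓ A hfire hstay q hlt.le
          rw [(htk q).1] at hle
          have := (htk q).2 t' (by omega)
          omega
        obtain ⟨C, hC1, hC2, hC3, hC4⟩ := ih hm q t' h2 htq (by simp) (by
          simp only [List.length_append, List.length_cons, List.length_nil]
          push_cast
          omega)
        refine ⟨C ++ [(x, s + 1)], ?_, by simp, ?_, by simp [← hC4]⟩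
        · rw [List.isChain_append]
          refine ⟨hC1, by simp, ?_⟩
          intro a ha b hb
          obtain rfl : (q, t') = a := by simpa [hC2] using ha
          obtain rfl : (x, s + 1) = b := by simpa using hb
          exact ⟨hqx, hev, Nat.succ_pos s, h2, Nat.lt_succ_of_le h1, h3⟩
        · intro e he
          rcases List.mem_append.1 he with he | he
          · exact hC3 e he
          · obtain rfl : e = (x, s + 1) := by simpa using he
            exact htp

/-- Let `k ≥ max_{p∈V} ℓ_0 p` and let `(p,t)` be an event with
`t ≥ t_{p,k}`.  Then: (a) for every `q` with `d(q,p) ≤ ℓ_t p − k` there is an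
event `(q,t')` with `t_{q,k} ≤ t'` and an in-segment causal chain from
`(q,t')` to `(p,t)`, i.e. `V(p, ℓ_t p − k) ⊆ Cover(p,t)` within
`[C_k, →[`; and (b) every simple walk of length at most `ℓ_t p − k` ending at
`p` belongs to `WalkCover_k(p,t)`. -/
theorem stmt_3 {V : Type*} [Fintype V] (G : SimpleGraph V) (hconn : G.Connected)
    (ℓ : ℕ → V → ℤ) (A : ℕ → Set V)
    (hA : ∀ t, (A t).Nonempty)
    (hguard : ∀ t, ∀ p ∈ A t, ∀ q, G.Adj p q → ℓ t q = ℓ t p ∨ ℓ t q = ℓ t p + 1)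
    (hfire : ∀ t, ∀ p ∈ A t, ℓ (t + 1) p = ℓ t p + 1)
    (hstay : ∀ t, ∀ p, p ∉ A t → ℓ (t + 1) p = ℓ t p)
    (hinit : ∀ p q, G.Adj p q → |ℓ 0 p - ℓ 0 q| ≤ 1)
    (hfair : ∀ (p : V) (t : ℕ), ∃ t', t ≤ t' ∧ p ∈ A t')
    (k : ℤ) (hk : ∀ p : V, ℓ 0 p ≤ k)
    (tk : V → ℕ)
    (htk : ∀ p : V, ℓ (tk p) p = k ∧ ∀ t, ℓ t p = k → tk p ≤ t) :
    ∀ (p : V) (t : ℕ), IsEvent A p t → tk p ≤ t →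
      (∀ q : V, (G.dist q p : ℤ) ≤ ℓ t p - k →
        ∃ C : List (V × ℕ), C ≠ [] ∧ List.Chain' (Leadsto G A) C ∧
          C.getLast? = some (p, t) ∧ (∀ e ∈ C, tk e.1 ≤ e.2) ∧
          ∃ t', tk q ≤ t' ∧ C.head? = some (q, t')) ∧
      (∀ m : List V, IsWalk G m → m.Nodup → m.getLast? = some p →
        ((m.length : ℤ) - 1 ≤ ℓ t p - k) → m ∈ WalkCoverSeg G A tk p t) := by
  intro p t hev htp
  have key := fun m hm => exists_causal_chain_of_walk G ℓ A hguard hfire hstay k hk tk htk m hm p t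
    hev htp
  refine ⟨fun q hq => ?_, fun m hm _ hlast hlen => ?_⟩
  · obtain ⟨w, hw⟩ := hconn.exists_walk_length_eq_dist q p
    obtain ⟨C, hC1, hC2, hC3, hC4⟩ := key w.support
      (w.isChain_adj_support.imp fun _ _ h => Or.inr h)
      (by rw [List.getLast?_eq_some_getLast w.support_ne_nil, w.getLast_support])
      (by rw [w.length_support, hw]; push_cast; omega)
    rcases C with _ | ⟨⟨q', t'⟩, C⟩
    · simp at hC2
    · have hq' : q = q' := by
        have := congrArg List.head? hC4
        rw [List.head?_eq_some_head w.support_ne_nil, w.head_support] at this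
        simpa using this
      subst hq'
      exact ⟨_, List.cons_ne_nil _ _, hC1, hC2, hC3, t', hC3 _ List.mem_cons_self, rfl⟩
  · obtain ⟨C, hC1, hC2, hC3, hC4⟩ := key m hm.2 hlast hlen
    exact Or.inr ⟨C, by rintro rfl; simp at hC2, hC1, hC2, hC3, hC4⟩
end

section
/- For every k ≥ max_{p∈V} ℓ_0 p, the cut C_k is coherent: for every event (q,t') and every p ∈ V, if (q,t') ⪯ (p, t_{p,k}) then t' ≤ t_{q,k}. -/
theorem monotone_label {V : Type*} {ℓ : ℕ → V → ℤ} {A : ℕ → Set V}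
    (hfire : ∀ t, ∀ p ∈ A t, ℓ (t + 1) p = ℓ t p + 1)
    (hstay : ∀ t, ∀ p, p ∉ A t → ℓ (t + 1) p = ℓ t p) (p : V) :
    Monotone fun t => ℓ t p := by
  refine monotone_nat_of_le_succ fun t => ?_
  by_cases h : p ∈ A t
  · have := hfire t p h
    lia
  · exact (hstay t p h).ge

/-- A causal predecessor of an event never carries a larger label. -/
theorem Leadsto.label_le {V : Type*} {G : SimpleGraph V} {ℓ : ℕ → V → ℤ} {A : ℕ → Set V}
    (hguard : ∀ t, ∀ p ∈ A t, ∀ q, G.Adj p q → ℓ t q = ℓ t p ∨ ℓ t q = ℓ t p + 1)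
    (hfire : ∀ t, ∀ p ∈ A t, ℓ (t + 1) p = ℓ t p + 1)
    (hstay : ∀ t, ∀ p, p ∉ A t → ℓ (t + 1) p = ℓ t p)
    {e f : V × ℕ} (h : Leadsto G A e f) : ℓ e.2 e.1 ≤ ℓ f.2 f.1 := by
  obtain ⟨q, t'⟩ := e
  obtain ⟨p, t⟩ := f
  obtain ⟨hqp, hev, hpos, -, hlt, -⟩ := h
  dsimp only at *
  rcases hqp with rfl | hadj
  · exact monotone_label hfire hstay q hlt.le
  · obtain rfl | ⟨s, rfl, hs⟩ := hev
    · lia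
    · have hmono : ℓ t' q ≤ ℓ s q := monotone_label hfire hstay q (Nat.le_of_lt_succ hlt)
      have := hfire s p hs
      have := hguard s p hs q hadj.symm
      lia

/-- For every `k ≥ max_{p∈V} ℓ_0 p`, the cut
`C_k = {(p, t_{p,k}) : p ∈ V}` — where `t_{p,k}` is the least `t` with
`ℓ_t p = k` — is coherent: for every event `(q,t')` and every `p`, if
`(q,t') ⪯ (p, t_{p,k})` (causal order, the reflexive-transitive closure of
`⇝`), then `t' ≤ t_{q,k}`. -/
theorem stmt_4 {V : Type*} [Fintype V] (G : SimpleGraph V) (hconn : G.Connected)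
    (ℓ : ℕ → V → ℤ) (A : ℕ → Set V)
    (hA : ∀ t, (A t).Nonempty)
    (hguard : ∀ t, ∀ p ∈ A t, ∀ q, G.Adj p q → ℓ t q = ℓ t p ∨ ℓ t q = ℓ t p + 1)
    (hfire : ∀ t, ∀ p ∈ A t, ℓ (t + 1) p = ℓ t p + 1)
    (hstay : ∀ t, ∀ p, p ∉ A t → ℓ (t + 1) p = ℓ t p)
    (hinit : ∀ p q, G.Adj p q → |ℓ 0 p - ℓ 0 q| ≤ 1)
    (hfair : ∀ (p : V) (t : ℕ), ∃ t', t ≤ t' ∧ p ∈ A t')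
    (k : ℤ) (hk : ∀ p : V, ℓ 0 p ≤ k)
    (tk : V → ℕ)
    (htk : ∀ p : V, ℓ (tk p) p = k ∧ ∀ t, ℓ t p = k → tk p ≤ t) :
    ∀ (q : V) (t' : ℕ) (p : V), IsEvent A q t' →
      Relation.ReflTransGen (Leadsto G A) (q, t') (p, tk p) → t' ≤ tk q := by
  intro q t' p hev hle
  have hlabel : ∀ e f : V × ℕ, Relation.ReflTransGen (Leadsto G A) e f →
      ℓ e.2 e.1 ≤ ℓ f.2 f.1 := by
    intro e f h
    induction h with
    | refl => exact le_rfl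
    | tail _ hstep ih => exact ih.trans (hstep.label_le hguard hfire hstay)
  have hk' : ℓ t' q ≤ k := (hlabel _ _ hle).trans_eq (htk p).1
  obtain rfl | ⟨s, rfl, hs⟩ := hev
  · exact Nat.zero_le _
  · by_contra! hlt
    have hmono : ℓ (tk q) q ≤ ℓ s q := monotone_label hfire hstay q (Nat.le_of_lt_succ hlt)
    have := hfire s q hs
    have := (htk q).1
    lia
end

section
/- If δ is at least the maximal length of a simple walk in G, then for every p ∈ V, res(p, t_{p,k+δ}) = ⨁ Λ_p, the legitimate output of p (the ⊕-infimum of eval(μ) over all simple walks μ ending at p). Thus a strong wave can be used to solve the idempotent r-operator parametrized computation problem. -/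
/-- Evaluation of the `r`-operators along a walk, starting from value `x` at
vertex `p`. -/
def evalFrom {V S : Type*} (r : V → V → S → S) : S → V → List V → S
  | x, _, [] => x
  | x, p, q :: rest => evalFrom r (r p q x) q rest

/-- `eval(p₀p₁…p_n) = (r_{p_{n−1},p_n} ∘ ⋯ ∘ r_{p₀,p₁})(v₀(p₀))`. -/
def evalWalk {V S : Type*} [SemilatticeInf S] [OrderTop S]
    (r : V → V → S → S) (v₀ : V → S) : List V → S
  | [] => ⊤
  | p :: rest => evalFrom r (v₀ p) p rest

theorem evalFrom_append_singleton {V S : Type*} (r : V → V → S → S) (l : List V) :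
    ∀ (x : S) (a p : V), evalFrom r x a (l ++ [p]) =
      r ((a :: l).getLast (List.cons_ne_nil a l)) p (evalFrom r x a l) := by
  induction l with
  | nil => intro x a p; rfl
  | cons b l ih => intro x a p; simpa [evalFrom] using ih (r a b x) b p

theorem evalWalk_append_singleton {V S : Type*} [SemilatticeInf S] [OrderTop S]
    (r : V → V → S → S) (v₀ : V → S) {m : List V} {q : V} (hq : m.getLast? = some q) (p : V) :
    evalWalk r v₀ (m ++ [p]) = r q p (evalWalk r v₀ m) := by
  cases m with
  | nil => simp at hq
  | cons a l =>
    rw [List.getLast?_eq_some_getLast (List.cons_ne_nil a l)] at hq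
    rw [← Option.some.inj hq]
    exact evalFrom_append_singleton r l (v₀ a) a p

theorem isWalk_append_singleton {V : Type*} {G : SimpleGraph V} {m : List V} {q : V}
    (hq : m.getLast? = some q) (p : V) :
    IsWalk G (m ++ [p]) ↔ IsWalk G m ∧ (q = p ∨ G.Adj q p) := by
  have hm : m ≠ [] := by rintro rfl; simp at hq
  change _ ≠ [] ∧ List.IsChain _ _ ↔ (_ ≠ [] ∧ List.IsChain _ _) ∧ _
  simp [List.isChain_append, hq, hm]

theorem isWalk_singleton {V : Type*} (G : SimpleGraph V) (p : V) : IsWalk G [p] :=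
  ⟨List.cons_ne_nil p [], List.isChain_singleton p⟩

theorem IsWalk.of_append_left {V : Type*} {G : SimpleGraph V} {m l : List V}
    (h : IsWalk G (m ++ l)) (hm : m ≠ []) : IsWalk G m :=
  ⟨hm, (List.isChain_append.1 h.2).1⟩

theorem IsWalk.evalWalk_le_evalWalk_append {V S : Type*} {G : SimpleGraph V}
    [SemilatticeInf S] [OrderTop S] {r : V → V → S → S}
    (hidem : ∀ u v : V, (u = v ∨ G.Adj u v) → ∀ x : S, x ≤ r u v x) (v₀ : V → S)
    {m : List V} (hm : m ≠ []) (l : List V) (h : IsWalk G (m ++ l)) :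
    evalWalk r v₀ m ≤ evalWalk r v₀ (m ++ l) := by
  induction l using List.reverseRecOn with
  | nil => simp
  | append_singleton l c ih =>
    rw [← List.append_assoc] at h ⊢
    have hq := List.getLast?_eq_some_getLast (l := m ++ l) (by simp [hm])
    obtain ⟨h₁, h₂⟩ := (isWalk_append_singleton hq c).1 h
    rw [evalWalk_append_singleton r v₀ hq]
    exact (ih h₁).trans (hidem _ _ h₂ _)

/-- The simple walks of `G` ending at `p`. -/
def simpleWalksTo {V : Type*} (G : SimpleGraph V) (p : V) : Set (List V) :=
  {m | IsWalk G m ∧ m.Nodup ∧ m.getLast? = some p}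

theorem singleton_mem_simpleWalksTo {V : Type*} (G : SimpleGraph V) (p : V) :
    [p] ∈ simpleWalksTo G p :=
  ⟨isWalk_singleton G p, by simp, by simp⟩

/-- Extending a simple walk ending at `q` by a step to `p` and removing the cycle this may create
does not increase the evaluation. -/
theorem exists_simpleWalksTo_evalWalk_le {V S : Type*} {G : SimpleGraph V}
    [SemilatticeInf S] [OrderTop S] {r : V → V → S → S}
    (hidem : ∀ u v : V, (u = v ∨ G.Adj u v) → ∀ x : S, x ≤ r u v x) (v₀ : V → S)
    {q p : V} (hqp : q = p ∨ G.Adj q p) {m : List V} (hm : m ∈ simpleWalksTo G q) :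
    ∃ m' ∈ simpleWalksTo G p, evalWalk r v₀ m' ≤ r q p (evalWalk r v₀ m) := by
  obtain ⟨hw, hn, hq⟩ := hm
  by_cases hp : p ∈ m
  · obtain ⟨a, b, rfl⟩ := List.append_of_mem hp
    have e : a ++ p :: b = (a ++ [p]) ++ b := by simp
    rw [e] at hw hn hq ⊢
    refine ⟨a ++ [p], ⟨hw.of_append_left (by simp), (List.nodup_append.1 hn).1, by simp⟩, ?_⟩
    exact (IsWalk.evalWalk_le_evalWalk_append hidem v₀ (by simp) b hw).trans (hidem _ _ hqp _)
  · refine ⟨m ++ [p], ⟨(isWalk_append_singleton hq p).2 ⟨hw, hqp⟩, ?_, by simp⟩, ?_⟩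
    · rw [← List.concat_eq_append]
      exact hn.concat hp
    · exact (evalWalk_append_singleton r v₀ hq p).le

theorem exists_isEvent_last {V : Type*} {ℓ : ℕ → V → ℤ} {A : ℕ → Set V}
    (hstay : ∀ t, ∀ p, p ∉ A t → ℓ (t + 1) p = ℓ t p) (q : V) (t : ℕ) :
    ∃ s ≤ t, IsEvent A q s ∧ ℓ s q = ℓ t q ∧ ∀ u, s < u → u < t + 1 → ¬ IsEvent A q u := by
  induction t with
  | zero => exact ⟨0, le_rfl, Or.inl rfl, rfl, fun u h₁ h₂ => by omega⟩
  | succ t ih =>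
    by_cases hq : q ∈ A t
    · exact ⟨t + 1, le_rfl, Or.inr ⟨t, rfl, hq⟩, rfl, fun u h₁ h₂ => by omega⟩
    · obtain ⟨s, hst, hs, hl, hu⟩ := ih
      refine ⟨s, by omega, hs, by rw [hl, hstay t q hq], fun u h₁ h₂ => ?_⟩
      rcases Nat.lt_succ_iff_lt_or_eq.1 h₂ with h | rfl
      · exact hu u h₁ h
      · rintro (h | ⟨t', h, h'⟩)
        · omega
        · obtain rfl : t = t' := by omega
          exact hq h'

theorem exists_leadsto {V : Type*} {G : SimpleGraph V} {ℓ : ℕ → V → ℤ} {A : ℕ → Set V}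
    (hguard : ∀ t, ∀ p ∈ A t, ∀ q, G.Adj p q → ℓ t q = ℓ t p ∨ ℓ t q = ℓ t p + 1)
    (hfire : ∀ t, ∀ p ∈ A t, ℓ (t + 1) p = ℓ t p + 1)
    (hstay : ∀ t, ∀ p, p ∉ A t → ℓ (t + 1) p = ℓ t p)
    {p q : V} (hqp : q = p ∨ G.Adj q p) {t : ℕ} (ht : IsEvent A p t) (h0 : 0 < t) :
    ∃ s, Leadsto G A (q, s) (p, t) ∧ ℓ t p ≤ ℓ s q + 1 := by
  rcases ht with rfl | ⟨t, rfl, hp⟩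
  · omega
  obtain ⟨s, hst, hs, hl, hu⟩ := exists_isEvent_last hstay q t
  refine ⟨s, ⟨hqp, Or.inr ⟨t, rfl, hp⟩, h0, hs, Nat.lt_succ_of_le hst, hu⟩, ?_⟩
  rw [hl, hfire t p hp]
  rcases hqp with rfl | hadj
  · exact le_rfl
  · rcases hguard t p hp q hadj.symm with h | h <;> omega

theorem isEvent_of_first {V : Type*} {ℓ : ℕ → V → ℤ} {A : ℕ → Set V}
    (hstay : ∀ t, ∀ p, p ∉ A t → ℓ (t + 1) p = ℓ t p) {p : V} {t : ℕ}
    (ht : ∀ s, ℓ s p = ℓ t p → t ≤ s) : IsEvent A p t := by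
  cases t with
  | zero => exact Or.inl rfl
  | succ s =>
    refine Or.inr ⟨s, rfl, ?_⟩
    by_contra hp
    have := ht s (hstay s p hp).symm
    omega

/-- A map preserving binary meets preserves greatest lower bounds of nonempty finite families. -/
theorem exists_isGLB_image_of_finite {α S : Type*} [SemilatticeInf S] {F : Set α} (hF : F.Finite)
    (hne : F.Nonempty) (f : α → S) :
    ∃ x, IsGLB (f '' F) x ∧ ∀ g : S → S, (∀ x y, g (x ⊓ y) = g x ⊓ g y) →
      IsGLB ((fun a => g (f a)) '' F) (g x) := by
  have hne' : hF.toFinset.Nonempty := by simpa using hne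
  have key : ∀ f : α → S, IsGLB (f '' F) (hF.toFinset.inf' hne' f) := fun f =>
    ⟨by rintro _ ⟨a, ha, rfl⟩; exact Finset.inf'_le f (by simpa using ha),
      fun y hy => Finset.le_inf' hne' f fun a ha => hy ⟨a, by simpa using ha, rfl⟩⟩
  refine ⟨_, key f, fun g hg => ?_⟩
  rw [Finset.apply_inf'_eq_inf'_comp hne' g hg]
  exact key _

/-- If `δ` is at least the maximal length of a simple walk in
`G`, then for every `p ∈ V`, `res(p, t_{p,k+δ}) = ⨁ Λ_p`, the legitimate
output of `p`: the `⊕`-infimum (greatest lower bound for `≤_⊕`) of `eval(μ)`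
over all simple walks `μ` ending at `p`.  Thus a strong wave can be used to
solve the idempotent `r`-operator parametrized computation problem. -/
theorem stmt_10 {V : Type*} [Fintype V] (G : SimpleGraph V) (hconn : G.Connected)
    (ℓ : ℕ → V → ℤ) (A : ℕ → Set V)
    (hA : ∀ t, (A t).Nonempty)
    (hguard : ∀ t, ∀ p ∈ A t, ∀ q, G.Adj p q → ℓ t q = ℓ t p ∨ ℓ t q = ℓ t p + 1)
    (hfire : ∀ t, ∀ p ∈ A t, ℓ (t + 1) p = ℓ t p + 1)
    (hstay : ∀ t, ∀ p, p ∉ A t → ℓ (t + 1) p = ℓ t p)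
    (hinit : ∀ p q, G.Adj p q → |ℓ 0 p - ℓ 0 q| ≤ 1)
    (hfair : ∀ (p : V) (t : ℕ), ∃ t', t ≤ t' ∧ p ∈ A t')
    (k : ℤ) (hk : ∀ p : V, ℓ 0 p ≤ k)
    (δ : ℕ) (hδ : ∀ m : List V, IsWalk G m → m.Nodup → m.length ≤ δ + 1)
    (T : ℤ → V → ℕ)
    (hT : ∀ (m : ℤ) (p : V), k ≤ m →
      ℓ (T m p) p = m ∧ ∀ t, ℓ t p = m → T m p ≤ t)
    {S : Type*} [SemilatticeInf S] [OrderTop S]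
    (r : V → V → S → S)
    (hend : ∀ u v : V, (u = v ∨ G.Adj u v) → ∀ x y : S, r u v (x ⊓ y) = r u v x ⊓ r u v y)
    (hidem : ∀ u v : V, (u = v ∨ G.Adj u v) → ∀ x : S, x ≤ r u v x)
    (hid : ∀ (u : V) (x : S), r u u x = x)
    (v₀ : V → S)
    (res : V → ℕ → S)
    (hres₀ : ∀ p : V, res p (T k p) = v₀ p)
    (hresrec : ∀ (p : V) (t : ℕ), IsEvent A p t → T k p < t →
      IsGLB (insert (v₀ p)
        {x | ∃ (q : V) (tq : ℕ), Leadsto G A (q, tq) (p, t) ∧ T k q ≤ tq ∧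
          x = r q p (res q tq)}) (res p t)) :
    ∀ p : V,
      IsGLB (evalWalk r v₀ '' {m | IsWalk G m ∧ m.Nodup ∧ m.getLast? = some p})
        (res p (T (k + δ) p)) := by
  have hmono : ∀ p, Monotone fun t => ℓ t p := fun p => monotone_nat_of_le_succ fun t => by
    by_cases hp : p ∈ A t
    · have := hfire t p hp; omega
    · exact (hstay t p hp).ge
  have hTle : ∀ p t, k ≤ ℓ t p → T k p ≤ t := fun p t h => by
    by_contra! hlt
    have h₁ := (hT k p le_rfl).1
    have h₂ : ℓ t p ≤ ℓ (T k p) p := hmono p hlt.le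
    exact absurd ((hT k p le_rfl).2 t (by omega)) (by omega)
  have hrmono : ∀ u v, (u = v ∨ G.Adj u v) → Monotone (r u v) := fun u v huv x y hxy => by
    rw [← inf_eq_left.2 hxy, hend u v huv]
    exact inf_le_right
  have hlower : ∀ (m : List V) (p : V) (t : ℕ), IsWalk G m → m.getLast? = some p →
      IsEvent A p t → k + m.length ≤ ℓ t p + 1 → res p t ≤ evalWalk r v₀ m := by
    intro m
    induction m using List.reverseRecOn with
    | nil => intro p t h; exact absurd rfl h.1
    | append_singleton m c ih =>
      intro p t hw hlast hev hlev
      obtain rfl : c = p := by simpa using hlast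
      rw [List.length_append, List.length_singleton] at hlev
      push_cast at hlev
      rcases eq_or_ne m [] with rfl | hm
      · change res c t ≤ v₀ c
        rcases (hTle c t (by simpa using hlev)).eq_or_lt with h | h
        · rw [← h, hres₀]
        · exact (hresrec c t hev h).1 (Set.mem_insert _ _)
      · have hpos := List.length_pos_iff.2 hm
        have hlt : T k c < t := by
          refine lt_of_le_of_ne (hTle c t (by omega)) fun h => ?_
          have := (hT k c le_rfl).1
          rw [h] at this
          omega
        have hq := List.getLast?_eq_some_getLast hm
        obtain ⟨hw', hqc⟩ := (isWalk_append_singleton hq c).1 hw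
        obtain ⟨s, hs, hsl⟩ := exists_leadsto hguard hfire hstay hqc hev (by omega)
        rw [evalWalk_append_singleton r v₀ hq]
        exact ((hresrec c t hev hlt).1 (Set.mem_insert_of_mem _
          ⟨_, s, hs, hTle _ s (by omega), rfl⟩)).trans
          (hrmono _ _ hqc (ih _ s hw' hq hs.2.2.2.1 (by omega)))
  have hfin : ∀ p, (simpleWalksTo G p).Finite := fun p =>
    (List.finite_length_le V (δ + 1)).subset fun m hm => hδ m hm.1 hm.2.1
  choose L hL hLmap using fun p => exists_isGLB_image_of_finite (hfin p)
    ⟨_, singleton_mem_simpleWalksTo G p⟩ (evalWalk r v₀)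
  have hLr : ∀ q p, (q = p ∨ G.Adj q p) → L p ≤ r q p (L q) := fun q p hqp => by
    refine (hLmap q (r q p) (hend q p hqp)).2 ?_
    rintro _ ⟨m, hm, rfl⟩
    obtain ⟨m', hm', hle⟩ := exists_simpleWalksTo_evalWalk_le hidem v₀ hqp hm
    exact ((hL p).1 ⟨m', hm', rfl⟩).trans hle
  have hLv : ∀ p, L p ≤ v₀ p := fun p => (hL p).1 ⟨[p], singleton_mem_simpleWalksTo G p, rfl⟩
  have hupper : ∀ (t : ℕ) (p : V), IsEvent A p t → T k p ≤ t → L p ≤ res p t := by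
    intro t
    induction t using Nat.strong_induction_on with
    | _ t ih =>
      intro p hev hle
      rcases hle.eq_or_lt with h | h
      · rw [← h, hres₀]
        exact hLv p
      · refine (hresrec p t hev h).2 ?_
        rintro _ (rfl | ⟨q, s, hs, hqs, rfl⟩)
        · exact hLv p
        · exact (hLr q p hs.1).trans (hrmono _ _ hs.1 (ih s hs.2.2.2.2.1 q hs.2.2.2.1 hqs))
  intro p
  obtain ⟨hlev, hfirst⟩ := hT (k + δ) p (by omega)
  have hev : IsEvent A p (T (k + δ) p) :=
    isEvent_of_first hstay fun s hs => hfirst s (hs.trans hlev)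
  refine ⟨?_, fun y hy => ((hL p).2 hy).trans (hupper _ p hev (hTle p _ (by omega)))⟩
  rintro _ ⟨m, ⟨hw, hn, hlast⟩, rfl⟩
  have := hδ m hw hn
  exact hlower m p _ hw hlast hev (by omega)
end

section
/- Let m and m' be walks with m →* m'. Then eval(m) ≥_⊕ eval(m'); and if moreover m is elementary, then eval(m) = eval(m'). -/
/-- A circular walk: length at least 1 and first vertex = last vertex. -/
def IsCircular {V : Type*} (G : SimpleGraph V) (u : List V) : Prop :=
  IsWalk G u ∧ 2 ≤ u.length ∧ u.head? = u.getLast?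

/-- One step of the rewriting relation on walks. -/
def StepRw {V : Type*} (G : SimpleGraph V) (m m' : List V) : Prop :=
  ∃ (m₁ u m₂ : List V) (h : V), IsCircular G u ∧ u.head? = some h ∧
    m = m₁ ++ u ++ m₂ ∧ m' = m₁ ++ [h] ++ m₂

/-- `m →* m'`. -/
def RwStar {V : Type*} (G : SimpleGraph V) : List V → List V → Prop :=
  Relation.ReflTransGen (StepRw G)

/-- An elementary walk: `q_i = q_j` with `i ≤ j` implies `q_k = q_i` for all
`i ≤ k ≤ j`. -/
def Elementary {V : Type*} (m : List V) : Prop :=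
  ∀ i j k : ℕ, i ≤ k → k ≤ j → j < m.length → m[i]? = m[j]? → m[k]? = m[i]?

section RewriteEval

variable {V S : Type*}

theorem Elementary.of_sublist {m m' : List V} (hm : Elementary m) (h : m'.Sublist m) :
    Elementary m' := by
  obtain ⟨f, hf⟩ := List.sublist_iff_exists_orderEmbedding_getElem?_eq.1 h
  intro i j k hik hkj hj hij
  rw [hf, hf i]
  refine hm (f i) (f j) (f k) (f.monotone hik) (f.monotone hkj) ?_ (by rw [← hf, ← hf, hij])
  have hsome : (m[f j]?).isSome := by
    rw [← hf]
    simpa using hj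
  simpa using hsome

/-- An elementary circular walk is constant. -/
theorem Elementary.eq_of_mem_of_cons_append {h : V} {w : List V}
    (hm : Elementary (h :: (w ++ [h]))) : ∀ x ∈ w ++ [h], x = h := by
  intro x hx
  obtain ⟨k, hk, rfl⟩ := List.getElem_of_mem hx
  have hk' : k < w.length + 1 := by simpa using hk
  have key := hm 0 (w.length + 1) (k + 1) (by omega) (by omega) (by simp) (by simp)
  rw [List.getElem?_cons_succ, List.getElem?_eq_getElem hk] at key
  simpa using key

theorem IsCircular.exists_eq_cons_append {G : SimpleGraph V} {u : List V} {h : V}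
    (hu : IsCircular G u) (hh : u.head? = some h) : ∃ w, u = h :: (w ++ [h]) := by
  obtain ⟨-, hlen, hlast⟩ := hu
  match u with
  | [] => simp at hh
  | a :: t =>
    obtain rfl : a = h := by simpa using hh
    rcases List.eq_nil_or_concat' t with rfl | ⟨w, b, rfl⟩
    · simp at hlen
    · refine ⟨w, ?_⟩
      have hab : a = b := by
        rw [← List.cons_append, List.getLast?_concat] at hlast
        simpa using hlast
      rw [← hab]

theorem StepRw.exists_split {G : SimpleGraph V} {m m' : List V} (hs : StepRw G m m') :
    ∃ (m₁ w m₂ : List V) (h : V),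
      m = m₁ ++ h :: (w ++ h :: m₂) ∧ m' = m₁ ++ h :: m₂ := by
  obtain ⟨m₁, u, m₂, h, hu, hh, rfl, rfl⟩ := hs
  obtain ⟨w, rfl⟩ := hu.exists_eq_cons_append hh
  exact ⟨m₁, w, m₂, h, by simp, by simp⟩

theorem StepRw.sublist {G : SimpleGraph V} {m m' : List V} (hs : StepRw G m m') :
    m'.Sublist m := by
  obtain ⟨m₁, w, m₂, h, rfl, rfl⟩ := hs.exists_split
  exact (List.Sublist.cons h (List.sublist_append_right w (h :: m₂))).append_left m₁

theorem StepRw.isWalk {G : SimpleGraph V} {m m' : List V} (hs : StepRw G m m')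
    (hm : IsWalk G m) : IsWalk G m' := by
  obtain ⟨m₁, w, m₂, h, rfl, rfl⟩ := hs.exists_split
  have hchain := List.isChain_split.1 hm.2
  refine ⟨by simp, List.isChain_split.2 ⟨hchain.1, ?_⟩⟩
  rw [← List.cons_append] at hchain
  exact (List.isChain_split.1 hchain.2).2

theorem evalFrom_append_cons (r : V → V → S → S) (x : S) (p h : V) (l t : List V) :
    evalFrom r x p (l ++ h :: t) = evalFrom r (evalFrom r x p (l ++ [h])) h t := by
  induction l generalizing x p with
  | nil => rfl
  | cons a l ih => exact ih _ _

theorem evalWalk_append_cons [SemilatticeInf S] [OrderTop S] (r : V → V → S → S) (v₀ : V → S)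
    (h : V) (l t : List V) :
    evalWalk r v₀ (l ++ h :: t) = evalFrom r (evalWalk r v₀ (l ++ [h])) h t := by
  cases l with
  | nil => rfl
  | cons a l => exact evalFrom_append_cons r _ a h l t

theorem evalFrom_eq_of_forall_eq {r : V → V → S → S} (hid : ∀ u x, r u u x = x) (x : S) {p : V}
    {l : List V} (hl : ∀ a ∈ l, a = p) : evalFrom r x p l = x := by
  induction l with
  | nil => rfl
  | cons a l ih =>
    obtain rfl : a = p := hl a (by simp)
    rw [evalFrom, hid]
    exact ih fun b hb => hl b (by simp [hb])

theorem le_evalFrom [Preorder S] {R : V → V → Prop} {r : V → V → S → S}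
    (hr : ∀ u v, R u v → ∀ x, x ≤ r u v x) (x : S) {p : V} {l : List V}
    (hl : (p :: l).IsChain R) : x ≤ evalFrom r x p l := by
  induction l generalizing x p with
  | nil => exact le_rfl
  | cons a l ih =>
    rw [List.isChain_cons_cons] at hl
    exact (hr p a hl.1 x).trans (ih _ hl.2)

theorem evalFrom_mono [Preorder S] {R : V → V → Prop} {r : V → V → S → S}
    (hr : ∀ u v, R u v → Monotone (r u v)) {x y : S} (hxy : x ≤ y) {p : V} {l : List V}
    (hl : (p :: l).IsChain R) : evalFrom r x p l ≤ evalFrom r y p l := by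
  induction l generalizing x y p with
  | nil => exact hxy
  | cons a l ih =>
    rw [List.isChain_cons_cons] at hl
    exact ih (hr p a hl.1 hxy) hl.2

theorem StepRw.evalWalk_le [SemilatticeInf S] [OrderTop S] {G : SimpleGraph V}
    {r : V → V → S → S} (hmono : ∀ u v, u = v ∨ G.Adj u v → Monotone (r u v))
    (hinfl : ∀ u v, u = v ∨ G.Adj u v → ∀ x, x ≤ r u v x) (v₀ : V → S)
    {m m' : List V} (hs : StepRw G m m') (hm : IsWalk G m) :
    evalWalk r v₀ m' ≤ evalWalk r v₀ m := by
  obtain ⟨m₁, w, m₂, h, rfl, rfl⟩ := hs.exists_split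
  have hchain := (List.isChain_split.1 hm.2).2
  rw [← List.cons_append] at hchain
  obtain ⟨hw, hm₂⟩ := List.isChain_split.1 hchain
  rw [evalWalk_append_cons r v₀ h m₁ m₂, evalWalk_append_cons r v₀ h m₁ (w ++ h :: m₂),
    evalFrom_append_cons]
  exact evalFrom_mono hmono (le_evalFrom hinfl _ hw) hm₂

theorem StepRw.evalWalk_eq [SemilatticeInf S] [OrderTop S] {G : SimpleGraph V}
    {r : V → V → S → S} (hid : ∀ u x, r u u x = x) (v₀ : V → S)
    {m m' : List V} (hs : StepRw G m m') (hm : Elementary m) :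
    evalWalk r v₀ m = evalWalk r v₀ m' := by
  obtain ⟨m₁, w, m₂, h, rfl, rfl⟩ := hs.exists_split
  have hw : Elementary (h :: (w ++ [h])) := by
    refine hm.of_sublist (List.Sublist.trans ?_ (List.sublist_append_right m₁ _))
    simp
  rw [evalWalk_append_cons r v₀ h m₁ m₂, evalWalk_append_cons r v₀ h m₁ (w ++ h :: m₂),
    evalFrom_append_cons, evalFrom_eq_of_forall_eq hid _ hw.eq_of_mem_of_cons_append]

end RewriteEval


/-- Let `m` and `m'` be walks with `m →* m'`.  Then
`eval(m) ≥_⊕ eval(m')` (i.e. `eval(m') ≤ eval(m)` in the meet-semilattice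
order `x ≤_⊕ y ↔ x ⊕ y = x`); if moreover `m` is elementary, then
`eval(m) = eval(m')`. -/
theorem stmt_14 {V : Type*} [Fintype V] (G : SimpleGraph V)
    {S : Type*} [SemilatticeInf S] [OrderTop S]
    (r : V → V → S → S)
    (hend : ∀ u v : V, (u = v ∨ G.Adj u v) → ∀ x y : S, r u v (x ⊓ y) = r u v x ⊓ r u v y)
    (hidem : ∀ u v : V, (u = v ∨ G.Adj u v) → ∀ x : S, x ≤ r u v x)
    (hid : ∀ (u : V) (x : S), r u u x = x)
    (v₀ : V → S) :
    ∀ m m' : List V, IsWalk G m → RwStar G m m' →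
      evalWalk r v₀ m' ≤ evalWalk r v₀ m ∧
      (Elementary m → evalWalk r v₀ m = evalWalk r v₀ m') := by
  intro m m' hm hs
  have hmono : ∀ u v, u = v ∨ G.Adj u v → Monotone (r u v) := fun u v huv x y hxy => by
    rw [← inf_eq_left, ← hend u v huv, inf_eq_left.2 hxy]
  induction hs using Relation.ReflTransGen.head_induction_on with
  | refl => exact ⟨le_rfl, fun _ => rfl⟩
  | head hstep _ ih =>
    obtain ⟨hle, heq⟩ := ih (hstep.isWalk hm)
    exact ⟨hle.trans (hstep.evalWalk_le hmono hidem v₀ hm), fun he =>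
      (hstep.evalWalk_eq hid v₀ he).trans (heq (he.of_sublist hstep.sublist))⟩
end
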